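/- Let M̂ and ΔM̂ be real n×n matrices and R̂ a real n×n matrix such that M̂ + ΔM̂ = R̂ᵀR̂ with |ΔM̂| ≤ ε_chol |R̂ᵀ||R̂| entrywise. Write R̂ = B_R · D_R, where D_R is the diagonal matrix whose diagonal entries are the (positive) column norms of R̂, so the columns of B_R have unit Euclidean norm. Then ‖D_R⁻¹ ΔM̂ D_R⁻¹‖ ≤ n · ε_chol · ‖B_R‖². -/

import Mathlib

open Matrix BigOperators

/-- Euclidean norm of a vector. -/
noncomputable def vnorm {k : ℕ} (v : Fin k → ℝ) : ℝ := Real.sqrt (∑ i, (v i)^2)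

/-- Spectral norm (operator 2-norm) of a real matrix. -/
noncomputable def spec {m n : ℕ} (A : Matrix (Fin m) (Fin n) ℝ) : ℝ :=
  ‖(Matrix.toEuclideanLin A).toContinuousLinearMap‖

/-- Moore–Penrose pseudoinverse of a full-column-rank matrix. -/
noncomputable def pinv {m n : ℕ} (A : Matrix (Fin m) (Fin n) ℝ) : Matrix (Fin n) (Fin m) ℝ :=
  (Aᵀ * A)⁻¹ * Aᵀ

/-- Condition number κ(B) = ‖B‖ ‖B†‖. -/
noncomputable def kappa {m n : ℕ} (B : Matrix (Fin m) (Fin n) ℝ) : ℝ :=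
  spec B * spec (pinv B)

theorem vnorm_eq_norm {k : ℕ} (v : Fin k → ℝ) : vnorm v = ‖WithLp.toLp 2 v‖ := by
  simp [vnorm, EuclideanSpace.norm_eq]

/-- An `n × n` matrix with entries bounded by `c` has spectral norm at most `n * c`. -/
theorem spec_le_of_abs_le {n : ℕ} (A : Matrix (Fin n) (Fin n) ℝ) {c : ℝ} (hc : 0 ≤ c)
    (hA : ∀ i j, |A i j| ≤ c) : spec A ≤ n * c := by
  refine ContinuousLinearMap.opNorm_le_bound _ (by positivity) fun x => ?_
  refine le_of_sq_le_sq ?_ (by positivity)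
  rw [mul_pow, EuclideanSpace.real_norm_sq_eq, EuclideanSpace.real_norm_sq_eq]
  have hrow : ∀ i, (∑ j, A i j * x j) ^ 2 ≤ n * c ^ 2 * ∑ j, x j ^ 2 := fun i => by
    refine (Finset.sum_mul_sq_le_sq_mul_sq _ _ _).trans ?_
    gcongr
    calc ∑ j, A i j ^ 2 ≤ ∑ _j : Fin n, c ^ 2 :=
          Finset.sum_le_sum fun j _ => sq_le_sq.mpr ((hA i j).trans (le_abs_self c))
      _ = n * c ^ 2 := by simp
  calc _ = ∑ i, (∑ j, A i j * x j) ^ 2 := by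
        simp [Matrix.toLpLin_apply, Matrix.mulVec, dotProduct]
    _ ≤ ∑ _i : Fin n, n * c ^ 2 * ∑ j, x j ^ 2 := Finset.sum_le_sum fun i _ => hrow i
    _ = _ := by simp; ring

theorem vnorm_col_le_spec {m n : ℕ} (A : Matrix (Fin m) (Fin n) ℝ) (j : Fin n) :
    vnorm (fun k => A k j) ≤ spec A := by
  have h := (Matrix.toEuclideanLin A).toContinuousLinearMap.le_opNorm
    (EuclideanSpace.single j 1)
  have hcol : Matrix.toEuclideanLin A (EuclideanSpace.single j 1) =
      WithLp.toLp 2 (fun k => A k j) := by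
    ext k
    simp [Matrix.toLpLin_apply]
  simpa [vnorm_eq_norm, spec, hcol] using h

theorem sum_abs_mul_abs_le_vnorm_mul_vnorm {k : ℕ} (u v : Fin k → ℝ) :
    ∑ i, |u i| * |v i| ≤ vnorm u * vnorm v := by
  simpa [vnorm] using
    Real.sum_mul_le_sqrt_mul_sqrt Finset.univ (fun i => |u i|) (fun i => |v i|)

theorem vnorm_mul_right {k : ℕ} (v : Fin k → ℝ) {a : ℝ} (ha : 0 ≤ a) :
    vnorm (fun i => v i * a) = vnorm v * a := by
  simp only [vnorm, mul_pow, ← Finset.sum_mul]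
  rw [Real.sqrt_mul (Finset.sum_nonneg fun i _ => sq_nonneg _), Real.sqrt_sq ha]

/-- scaled backward error of the Cholesky factorization. -/
theorem stmt_13 {n : ℕ} (Mh ΔMh Rh BR : Matrix (Fin n) (Fin n) ℝ)
    (εchol : ℝ) (hεchol : 0 ≤ εchol)
    (hchol : Mh + ΔMh = Rhᵀ * Rh)
    (hΔMh : ∀ i j, |ΔMh i j| ≤
      εchol * (((Rh.map (fun x => |x|))ᵀ * Rh.map (fun x => |x|)) i j))
    (dR : Fin n → ℝ)
    (hdR : ∀ i, dR i = vnorm (fun k => Rh k i))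
    (hdRpos : ∀ i, 0 < dR i)
    (hBR : Rh = BR * Matrix.diagonal dR) :
    spec (Matrix.diagonal (fun i => (dR i)⁻¹) * ΔMh *
        Matrix.diagonal (fun i => (dR i)⁻¹))
      ≤ (n : ℝ) * εchol * spec BR ^ 2 := by
  have hE : ∀ i j, |(Matrix.diagonal (fun i => (dR i)⁻¹) * ΔMh *
      Matrix.diagonal (fun i => (dR i)⁻¹)) i j| ≤ εchol := fun i j => by
    have hΔ : |ΔMh i j| ≤ εchol * (dR i * dR j) := by
      refine (hΔMh i j).trans (mul_le_mul_of_nonneg_left ?_ hεchol)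
      rw [hdR i, hdR j]
      simpa [Matrix.mul_apply] using
        sum_abs_mul_abs_le_vnorm_mul_vnorm (fun k => Rh k i) (fun k => Rh k j)
    have hi := hdRpos i
    have hj := hdRpos j
    rw [Matrix.mul_diagonal, Matrix.diagonal_mul, abs_mul, abs_mul,
      abs_of_pos (inv_pos.mpr hi), abs_of_pos (inv_pos.mpr hj)]
    calc (dR i)⁻¹ * |ΔMh i j| * (dR j)⁻¹
        ≤ (dR i)⁻¹ * (εchol * (dR i * dR j)) * (dR j)⁻¹ := by gcongr
      _ = εchol := by field_simp
  refine (spec_le_of_abs_le _ hεchol hE).trans ?_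
  rcases Nat.eq_zero_or_pos n with rfl | hn
  · simp
  · have hcol : vnorm (fun k => BR k ⟨0, hn⟩) = 1 := by
      have h := hdR ⟨0, hn⟩
      simp only [hBR, Matrix.mul_diagonal] at h
      rw [vnorm_mul_right _ (hdRpos _).le] at h
      exact (mul_eq_right₀ (hdRpos _).ne').mp h.symm
    have hB : 1 ≤ spec BR := hcol ▸ vnorm_col_le_spec BR ⟨0, hn⟩
    exact le_mul_of_one_le_right (by positivity) (one_le_pow₀ hB)
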